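/- arXiv:1912.01334 — 6 statements merged into one kernel-verified Lean document; each statement's English description precedes it below -/
import Mathlib

section
/- For every ℓ ∈ ℝ with ℓ ≠ 0, every c ∈ ℝ and every Schwartz function φ : ℝ → ℂ, the series Σ_{k∈ℤ} exp(2πiℓ(r − x(c/ℓ + 2k + y))) · φ(c/(2ℓ) + k + y) defining Θ_{ℓ,c}(φ)(x+iy, r) converges absolutely for every (x,y,r) ∈ ℝ³, and the resulting function (x,y,r) ↦ Θ_{ℓ,c}(φ)(x+iy, r) is smooth (C^∞) on ℝ³. -/
/-- The `k`-th term of the theta series `Θ_{ℓ,c}(φ)` at the point `n(x+iy, r)`. -/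
noncomputable def thetaTerm (ℓ c : ℝ) (φ : ℝ → ℂ) (x y r : ℝ) (k : ℤ) : ℂ :=
  Complex.exp (((2 * Real.pi * ℓ * (r - x * (c / ℓ + 2 * (k : ℝ) + y)) : ℝ) : ℂ) *
      Complex.I) *
    φ (c / (2 * ℓ) + (k : ℝ) + y)

/-- The theta function `Θ_{ℓ,c}(φ)(n(x+iy,r))`, as a function of `(x,y,r) ∈ ℝ³`. -/
noncomputable def thetaFun (ℓ c : ℝ) (φ : ℝ → ℂ) (x y r : ℝ) : ℂ :=
  ∑' k : ℤ, thetaTerm ℓ c φ x y r k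

open scoped ContDiff Topology SchwartzMap

/-- A series of smooth functions is smooth as soon as, on every closed ball, the derivatives of
each order of its terms have a summable uniform bound. -/
theorem contDiff_tsum_of_bound_on_closedBall {ι E F : Type*}
    [NormedAddCommGroup E] [NormedSpace ℝ E] [FiniteDimensional ℝ E]
    [NormedAddCommGroup F] [NormedSpace ℝ F] [CompleteSpace F] {f : ι → E → F}
    (hf : ∀ i, ContDiff ℝ ∞ (f i))
    (hbound : ∀ (x₀ : E) (R : ℝ) (n : ℕ), ∃ v : ι → ℝ, Summable v ∧
      ∀ i, ∀ x ∈ Metric.closedBall x₀ R, ‖iteratedFDeriv ℝ n (f i) x‖ ≤ v i) :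
    ContDiff ℝ ∞ fun x => ∑' i, f i x := by
  rw [contDiff_iff_contDiffAt]
  intro x₀
  let χ : ContDiffBump x₀ := ⟨1, 2, one_pos, one_lt_two⟩
  choose v hv hfv using hbound x₀ 2
  have hχ (n : ℕ) : ∃ B : ℝ, ∀ x, ‖iteratedFDeriv ℝ n χ x‖ ≤ B :=
    (χ.contDiff.continuous_iteratedFDeriv (m := n) (n := ∞)
      (mod_cast le_top)).bounded_above_of_compact_support (χ.hasCompactSupport.iteratedFDeriv n)
  choose B hB using hχ
  have hsmooth : ContDiff ℝ ∞ fun x => ∑' i, χ x • f i x := by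
    refine contDiff_tsum (N := ⊤)
      (v := fun n i => ∑ j ∈ Finset.range (n + 1), (n.choose j : ℝ) * B j * v (n - j) i)
      (fun i => χ.contDiff.smul (hf i))
      (fun n _ => summable_sum fun j _ => (hv (n - j)).mul_left _) ?_
    intro n i x _
    refine (norm_iteratedFDeriv_smul_le χ.contDiff (hf i) x
      (n := n) (mod_cast le_top)).trans ?_
    refine Finset.sum_le_sum fun j _ => ?_
    have hB0 : 0 ≤ B j := (norm_nonneg _).trans (hB j x)
    by_cases hx : x ∈ Metric.closedBall x₀ 2
    · gcongr
      · exact hB j x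
      · exact hfv (n - j) i x hx
    · have h0 : iteratedFDeriv ℝ j χ x = 0 := by
        by_contra hne
        have := support_iteratedFDeriv_subset (𝕜 := ℝ) j (Function.mem_support.2 hne)
        rw [χ.tsupport_eq] at this
        exact hx this
      have hv0 : 0 ≤ v (n - j) i :=
        (norm_nonneg _).trans (hfv (n - j) i x₀ (Metric.mem_closedBall_self zero_le_two))
      rw [h0, norm_zero, mul_zero, zero_mul]
      positivity
  refine hsmooth.contDiffAt.congr_of_eventuallyEq ?_
  filter_upwards [χ.eventuallyEq_one] with x hx
  simp [hx]

/-- The unitary character `t ↦ exp (i t)` of `ℝ` has temperate growth. -/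
theorem hasTemperateGrowth_cexp_ofReal_mul_I :
    Function.HasTemperateGrowth fun t : ℝ => Complex.exp (t * Complex.I) := by
  have hderiv (n : ℕ) : iteratedDeriv n (fun t : ℝ => Complex.exp (t * Complex.I)) =
      fun t : ℝ => Complex.I ^ n * Complex.exp (t * Complex.I) := by
    induction n with
    | zero => simp
    | succ n ih =>
      rw [iteratedDeriv_succ, ih]
      ext t
      have h : HasDerivAt (fun t : ℝ => (t : ℂ) * Complex.I) (1 * Complex.I) t :=
        (Complex.ofRealCLM.hasDerivAt (x := t)).mul_const Complex.I
      rw [(h.cexp.const_mul (Complex.I ^ n)).deriv]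
      ring
  refine ⟨(Complex.ofRealCLM.contDiff.mul contDiff_const).cexp, fun n => ⟨0, 1, fun t => ?_⟩⟩
  rw [norm_iteratedFDeriv_eq_norm_iteratedDeriv, hderiv]
  simp [Complex.norm_exp_ofReal_mul_I]

/-- The product of a function of temperate growth on `V × W` with a Schwartz function of the second
variable is rapidly decreasing in the second variable, with constants growing polynomially in the
first one. -/
theorem exists_norm_iteratedFDeriv_mul_schwartz_snd_le {V W : Type*}
    [NormedAddCommGroup V] [NormedSpace ℝ V] [NormedAddCommGroup W] [NormedSpace ℝ W]
    {g : V × W → ℂ} (hg : g.HasTemperateGrowth) (φ : 𝓢(W, ℂ)) (N n : ℕ) :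
    ∃ (m : ℕ) (C : ℝ), 0 ≤ C ∧ ∀ q : V × W,
      (1 + ‖q.2‖) ^ N * ‖iteratedFDeriv ℝ n (fun q : V × W => g q * φ q.2) q‖ ≤
        C * (1 + ‖q.1‖) ^ m := by
  obtain ⟨m, K, hK, hgK⟩ := hg.norm_iteratedFDeriv_le_uniform n
  set S : ℝ := 2 ^ (m + N) *
    (Finset.Iic (m + N, n)).sup (fun p => SchwartzMap.seminorm ℝ p.1 p.2) φ
  have hS (j : ℕ) (hj : j ≤ n) (w : W) : (1 + ‖w‖) ^ (m + N) * ‖iteratedFDeriv ℝ j φ w‖ ≤ S :=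
    SchwartzMap.one_add_le_sup_seminorm_apply (𝕜 := ℝ) (m := (m + N, n)) le_rfl hj φ w
  have hS0 : 0 ≤ S := le_trans (by positivity) (hS 0 n.zero_le 0)
  refine ⟨m, 2 ^ n * (K * S), by positivity, fun q => ?_⟩
  have hφ (j : ℕ) : ‖iteratedFDeriv ℝ j (fun q : V × W => φ q.2) q‖ ≤
      ‖iteratedFDeriv ℝ j φ q.2‖ := by
    have h := (ContinuousLinearMap.snd ℝ V W).iteratedFDeriv_comp_right (φ.smooth ⊤) q
      (i := j) (mod_cast le_top)
    change ‖iteratedFDeriv ℝ j (φ ∘ ContinuousLinearMap.snd ℝ V W) q‖ ≤ _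
    rw [h]
    refine (ContinuousMultilinearMap.norm_compContinuousLinearMap_le _ _).trans ?_
    refine mul_le_of_le_one_right (norm_nonneg _) ?_
    exact Finset.prod_le_one (fun _ _ => norm_nonneg _)
      fun _ _ => ContinuousLinearMap.norm_snd_le ℝ V W
  have hq : 1 + ‖q‖ ≤ (1 + ‖q.1‖) * (1 + ‖q.2‖) := by
    have h1 := norm_nonneg q.1
    have h2 := norm_nonneg q.2
    have h3 : ‖q‖ ≤ ‖q.1‖ + ‖q.2‖ := max_le_add_of_nonneg h1 h2
    nlinarith [mul_nonneg h1 h2]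
  have hsnd : ContDiff ℝ ∞ fun q : V × W => φ q.2 := (φ.smooth ⊤).comp contDiff_snd
  calc
    _ ≤ (1 + ‖q.2‖) ^ N * ∑ i ∈ Finset.range (n + 1), (n.choose i : ℝ) *
          ‖iteratedFDeriv ℝ i g q‖ * ‖iteratedFDeriv ℝ (n - i) (fun q : V × W => φ q.2) q‖ := by
      gcongr
      exact norm_iteratedFDeriv_mul_le hg.1 hsnd q (mod_cast le_top)
    _ ≤ ∑ i ∈ Finset.range (n + 1), (n.choose i : ℝ) * (K * S * (1 + ‖q.1‖) ^ m) := by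
      rw [Finset.mul_sum]
      refine Finset.sum_le_sum fun i hi => ?_
      calc
        _ ≤ (1 + ‖q.2‖) ^ N * ((n.choose i : ℝ) *
              (K * ((1 + ‖q.1‖) * (1 + ‖q.2‖)) ^ m) * ‖iteratedFDeriv ℝ (n - i) φ q.2‖) := by
          gcongr
          · exact (hgK i (Finset.mem_range_succ_iff.1 hi) q).trans (by gcongr)
          · exact hφ _
        _ = (n.choose i : ℝ) * (K * ((1 + ‖q.2‖) ^ (m + N) * ‖iteratedFDeriv ℝ (n - i) φ q.2‖) *
              (1 + ‖q.1‖) ^ m) := by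
          rw [mul_pow, pow_add]; ring
        _ ≤ _ := by
          gcongr
          exact hS _ (Nat.sub_le _ _) _
    _ = _ := by
      rw [← Finset.sum_mul, ← Nat.cast_sum, Nat.sum_range_choose]
      push_cast
      ring

theorem summable_one_div_one_add_abs_int_sq :
    Summable fun k : ℤ => 1 / (1 + |(k : ℝ)|) ^ 2 := by
  refine ((Real.summable_one_div_int_pow (p := 2)).2 one_lt_two).of_norm_bounded_eventually ?_
  filter_upwards [(Set.finite_singleton (0 : ℤ)).compl_mem_cofinite] with k hk
  have hk' : (0 : ℝ) < |(k : ℝ)| := abs_pos.2 (Int.cast_ne_zero.2 hk)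
  rw [Real.norm_of_nonneg (by positivity), ← sq_abs (k : ℝ)]
  gcongr
  linarith

/-- On every ball, the derivatives of each order of the terms of the theta series have a summable
uniform bound. -/
theorem exists_summable_norm_iteratedFDeriv_thetaTerm_le (ℓ : ℝ) (hℓ : ℓ ≠ 0) (c : ℝ)
    (φ : 𝓢(ℝ, ℂ)) (p₀ : ℝ × ℝ × ℝ) (R : ℝ) (n : ℕ) :
    ∃ v : ℤ → ℝ, Summable v ∧ ∀ k, ∀ p ∈ Metric.closedBall p₀ R,
      ‖iteratedFDeriv ℝ n (fun p : ℝ × ℝ × ℝ => thetaTerm ℓ c φ p.1 p.2.1 p.2.2 k) p‖ ≤ v k := by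
  let phase : (ℝ × ℝ × ℝ) × ℝ → ℝ := fun q =>
    2 * Real.pi * ℓ * (q.1.2.2 - q.1.1 * (2 * q.2 - q.1.2.1))
  have hphase : phase.HasTemperateGrowth := by
    have hfst : Function.HasTemperateGrowth fun q : (ℝ × ℝ × ℝ) × ℝ => q.1 :=
      (ContinuousLinearMap.fst ℝ (ℝ × ℝ × ℝ) ℝ).hasTemperateGrowth
    have ht : Function.HasTemperateGrowth fun q : (ℝ × ℝ × ℝ) × ℝ => q.2 :=
      (ContinuousLinearMap.snd ℝ (ℝ × ℝ × ℝ) ℝ).hasTemperateGrowth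
    have hx : Function.HasTemperateGrowth fun q : (ℝ × ℝ × ℝ) × ℝ => q.1.1 :=
      (ContinuousLinearMap.fst ℝ ℝ (ℝ × ℝ)).hasTemperateGrowth.comp hfst
    have hyr : Function.HasTemperateGrowth fun q : (ℝ × ℝ × ℝ) × ℝ => q.1.2 :=
      (ContinuousLinearMap.snd ℝ ℝ (ℝ × ℝ)).hasTemperateGrowth.comp hfst
    have hy : Function.HasTemperateGrowth fun q : (ℝ × ℝ × ℝ) × ℝ => q.1.2.1 :=
      (ContinuousLinearMap.fst ℝ ℝ ℝ).hasTemperateGrowth.comp hyr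
    have hr : Function.HasTemperateGrowth fun q : (ℝ × ℝ × ℝ) × ℝ => q.1.2.2 :=
      (ContinuousLinearMap.snd ℝ ℝ ℝ).hasTemperateGrowth.comp hyr
    exact (Function.HasTemperateGrowth.const _).mul
      (hr.sub (hx.mul (((Function.HasTemperateGrowth.const 2).mul ht).sub hy)))
  let G : (ℝ × ℝ × ℝ) × ℝ → ℂ := fun q => Complex.exp (phase q * Complex.I) * φ q.2
  have hexp := hasTemperateGrowth_cexp_ofReal_mul_I.comp hphase
  have hG : ContDiff ℝ ∞ G := hexp.1.mul ((φ.smooth ⊤).comp contDiff_snd)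
  obtain ⟨m, C, hC, hGC⟩ := exists_norm_iteratedFDeriv_mul_schwartz_snd_le hexp φ 2 n
  let L : ℝ × ℝ × ℝ →L[ℝ] (ℝ × ℝ × ℝ) × ℝ :=
    (ContinuousLinearMap.id ℝ (ℝ × ℝ × ℝ)).prod
      ((ContinuousLinearMap.fst ℝ ℝ ℝ).comp (ContinuousLinearMap.snd ℝ ℝ (ℝ × ℝ)))
  let a : ℝ := c / (2 * ℓ)
  let w : ℤ → (ℝ × ℝ × ℝ) × ℝ := fun k => (0, a + k)
  have hterm (k : ℤ) : (fun p : ℝ × ℝ × ℝ => thetaTerm ℓ c φ p.1 p.2.1 p.2.2 k) =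
      (fun q => G (q + w k)) ∘ L := by
    ext p
    have h : c / ℓ + 2 * (k : ℝ) + p.2.1 = 2 * (p.2.1 + (a + k)) - p.2.1 := by
      simp only [a]; field_simp; ring
    simp only [thetaTerm, h]
    simp [G, L, w, phase, a, add_comm]
  let M : ℝ := ‖p₀‖ + |R|
  have hM : 0 ≤ M := by positivity
  refine ⟨fun k => ‖L‖ ^ n * (C * (1 + M) ^ m * (1 + |a| + M) ^ 2) * (1 / (1 + |(k : ℝ)|) ^ 2),
    summable_one_div_one_add_abs_int_sq.mul_left _, fun k p hp => ?_⟩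
  have hpM : ‖p‖ ≤ M := by
    have h1 := norm_le_norm_add_norm_sub' p p₀
    have h2 := mem_closedBall_iff_norm.1 hp
    have h3 := le_abs_self R
    simp only [M]
    linarith
  let t : ℝ := p.2.1 + (a + k)
  have hk : 1 + |(k : ℝ)| ≤ (1 + |a| + M) * (1 + |t|) := by
    have hy : |p.2.1| ≤ M := ((norm_fst_le p.2).trans (norm_snd_le p)).trans hpM
    have h1 : |(k : ℝ)| ≤ |t| + |p.2.1| + |a| := by
      have : (k : ℝ) = t - p.2.1 - a := by simp only [t]; ring
      rw [this]
      exact (abs_sub _ _).trans (by gcongr; exact abs_sub _ _)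
    nlinarith [abs_nonneg a, abs_nonneg t, mul_nonneg (abs_nonneg a) (abs_nonneg t),
      mul_nonneg hM (abs_nonneg t)]
  have hbound : ‖iteratedFDeriv ℝ n G (L p + w k)‖ ≤
      C * (1 + M) ^ m * (1 + |a| + M) ^ 2 * (1 / (1 + |(k : ℝ)|) ^ 2) := by
    have h := hGC (L p + w k)
    have hfst : (L p + w k).1 = p := by simp [L, w]
    have hsnd : (L p + w k).2 = t := by simp [L, w, t]
    rw [hfst, hsnd, Real.norm_eq_abs] at h
    change (1 + |t|) ^ 2 * ‖iteratedFDeriv ℝ n G (L p + w k)‖ ≤ _ at h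
    rw [mul_one_div, le_div_iff₀ (by positivity)]
    calc
      _ ≤ ‖iteratedFDeriv ℝ n G (L p + w k)‖ * ((1 + |a| + M) * (1 + |t|)) ^ 2 := by gcongr
      _ = (1 + |t|) ^ 2 * ‖iteratedFDeriv ℝ n G (L p + w k)‖ * (1 + |a| + M) ^ 2 := by ring
      _ ≤ C * (1 + ‖p‖) ^ m * (1 + |a| + M) ^ 2 := by gcongr
      _ ≤ _ := by gcongr
  have hshift : ContDiff ℝ ∞ fun q => G (q + w k) := hG.comp (contDiff_id.add contDiff_const)
  rw [hterm, L.iteratedFDeriv_comp_right hshift p (mod_cast le_top), iteratedFDeriv_comp_add_right]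
  refine (ContinuousMultilinearMap.norm_compContinuousLinearMap_le _ _).trans ?_
  rw [Finset.prod_const, Finset.card_fin, mul_comm]
  dsimp only
  rw [mul_assoc (‖L‖ ^ n)]
  gcongr

theorem contDiff_thetaTerm (ℓ c : ℝ) (φ : 𝓢(ℝ, ℂ)) (k : ℤ) :
    ContDiff ℝ ∞ fun p : ℝ × ℝ × ℝ => thetaTerm ℓ c φ p.1 p.2.1 p.2.2 k := by
  have hphase : ContDiff ℝ ∞ fun p : ℝ × ℝ × ℝ =>
      2 * Real.pi * ℓ * (p.2.2 - p.1 * (c / ℓ + 2 * (k : ℝ) + p.2.1)) := by fun_prop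
  have harg : ContDiff ℝ ∞ fun p : ℝ × ℝ × ℝ => c / (2 * ℓ) + (k : ℝ) + p.2.1 := by fun_prop
  exact ((Complex.ofRealCLM.contDiff.comp hphase).mul contDiff_const).cexp.mul
    ((φ.smooth ⊤).comp harg)

/-- For a Schwartz function `φ`, the series defining `Θ_{ℓ,c}(φ)` converges absolutely at
every point of `ℝ³`, and the resulting function is smooth on `ℝ³`. -/
theorem stmt_4 (ℓ : ℝ) (hℓ : ℓ ≠ 0) (c : ℝ) (φ : SchwartzMap ℝ ℂ) :
    (∀ x y r : ℝ, Summable fun k : ℤ => ‖thetaTerm ℓ c (⇑φ) x y r k‖) ∧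
    ContDiff ℝ (⊤ : ℕ∞) (fun p : ℝ × ℝ × ℝ => thetaFun ℓ c (⇑φ) p.1 p.2.1 p.2.2) := by
  have hbound := exists_summable_norm_iteratedFDeriv_thetaTerm_le ℓ hℓ c φ
  refine ⟨fun x y r => ?_, contDiff_tsum_of_bound_on_closedBall (contDiff_thetaTerm ℓ c φ) hbound⟩
  obtain ⟨v, hv, hle⟩ := hbound (x, y, r) 0 0
  refine hv.of_nonneg_of_le (fun _ => norm_nonneg _) fun k => ?_
  simpa only [norm_iteratedFDeriv_zero] using hle k (x, y, r) (Metric.mem_closedBall_self le_rfl)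
end

section
/- For all ℓ ∈ ℝ∖{0}, c ∈ ℝ, every Schwartz function φ : ℝ → ℂ, and every (b,r) ∈ ℂ × ℝ: Θ_{ℓ,c}(φ)((1/(2ℓ), 0)·(b,r)) = exp(−πic/ℓ) · Θ_{ℓ,c}(φ)(b,r), and Θ_{ℓ,c}(φ)((i/(2ℓ), 0)·(b,r)) = Θ_{ℓ,c+1}(φ)(b,r), where · denotes the Heisenberg multiplication. -/
/-- Multiplication of the Heisenberg group `N = ℂ × ℝ`:
`(b,r)·(b′,r′) = (b+b′, r+r′+Im(conj b · b′))`. -/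
noncomputable def heisMul (p q : ℂ × ℝ) : ℂ × ℝ :=
  (p.1 + q.1, p.2 + q.2 + ((starRingEnd ℂ) p.1 * q.1).im)

/-- The theta function `Θ_{ℓ,c}(φ)` on the Heisenberg group `ℂ × ℝ`. -/
noncomputable def Theta (ℓ c : ℝ) (φ : ℝ → ℂ) (p : ℂ × ℝ) : ℂ :=
  ∑' k : ℤ,
    Complex.exp (((2 * Real.pi * ℓ * (p.2 - p.1.re * (c / ℓ + 2 * (k : ℝ) + p.1.im)) : ℝ) : ℂ) *
        Complex.I) *
      φ (c / (2 * ℓ) + (k : ℝ) + p.1.im)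

/-- The behavior of theta functions under left translation by `n(1/(2ℓ),0)` and by
`n(i/(2ℓ),0)`. -/
theorem stmt_5 (ℓ : ℝ) (hℓ : ℓ ≠ 0) (c : ℝ) (φ : SchwartzMap ℝ ℂ) (b : ℂ) (r : ℝ) :
    Theta ℓ c (⇑φ) (heisMul (((1 / (2 * ℓ) : ℝ) : ℂ), 0) (b, r))
      = Complex.exp (((-(Real.pi * c / ℓ) : ℝ) : ℂ) * Complex.I) * Theta ℓ c (⇑φ) (b, r) ∧
    Theta ℓ c (⇑φ) (heisMul (Complex.I * ((1 / (2 * ℓ) : ℝ) : ℂ), 0) (b, r))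
      = Theta ℓ (c + 1) (⇑φ) (b, r) := by
  constructor
  · unfold Theta heisMul
    rw [← tsum_mul_left]
    refine tsum_congr fun k => ?_
    rw [← mul_assoc, ← Complex.exp_add]
    congr 1
    · refine Complex.exp_eq_exp_iff_exists_int.mpr ⟨-k, ?_⟩
      simp only [Complex.add_re, Complex.add_im, Complex.ofReal_re, Complex.ofReal_im,
        Complex.conj_ofReal, Complex.im_ofReal_mul]
      have hℓ' : (ℓ : ℂ) ≠ 0 := Complex.ofReal_ne_zero.mpr hℓ
      push_cast
      field_simp
      ring
    · simp
  · unfold Theta heisMul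
    refine tsum_congr fun k => ?_
    congr 1
    · congr 3
      simp only [Complex.add_re, Complex.add_im, Complex.mul_re, Complex.mul_im, Complex.I_re,
        Complex.I_im, Complex.ofReal_re, Complex.ofReal_im, Complex.conj_re, Complex.conj_im]
      field_simp
      ring
    · congr 1
      simp only [Complex.add_im, Complex.mul_im, Complex.I_re, Complex.I_im, Complex.ofReal_re,
        Complex.ofReal_im]
      field_simp
      ring
end

section
/- Let σ ∈ ℤ with σ ≥ 1, let ℓ ∈ (σ/2)·ℤ with ℓ ≠ 0, and let c ∈ ℤ. Then for every Schwartz function φ : ℝ → ℂ the theta function Θ_{ℓ,c}(φ) is invariant under left translation by each of the three generators of the standard lattice Λ_σ: Θ_{ℓ,c}(φ)(γ·(b,r)) = Θ_{ℓ,c}(φ)(b,r) for all (b,r) ∈ ℂ × ℝ and each γ ∈ {(1,0), (i,0), (0, 2/σ)} (Heisenberg multiplication); consequently Θ_{ℓ,c}(φ)(γ·(b,r)) = Θ_{ℓ,c}(φ)(b,r) for every γ in the subgroup of the Heisenberg group generated by these three elements. -/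
/-- The Heisenberg group `N`: the set `ℂ × ℝ` with multiplication
`(b,r)·(b′,r′) = (b+b′, r+r′+Im(conj b · b′))`. -/
@[ext]
structure Heis where
  z : ℂ
  t : ℝ

namespace Heis

noncomputable instance : Mul Heis :=
  ⟨fun p q => ⟨p.z + q.z, p.t + q.t + ((starRingEnd ℂ) p.z * q.z).im⟩⟩

noncomputable instance : One Heis := ⟨⟨0, 0⟩⟩

noncomputable instance : Inv Heis := ⟨fun p => ⟨-p.z, -p.t⟩⟩

theorem mul_def (p q : Heis) :
    p * q = ⟨p.z + q.z, p.t + q.t + ((starRingEnd ℂ) p.z * q.z).im⟩ := rfl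

theorem one_def : (1 : Heis) = ⟨0, 0⟩ := rfl

theorem inv_def (p : Heis) : p⁻¹ = ⟨-p.z, -p.t⟩ := rfl

noncomputable instance : Group Heis :=
  Group.ofLeftAxioms
    (fun a b c => by
      simp only [mul_def]
      ext
      · simp [add_assoc]
      · simp only [map_add, add_mul, mul_add, Complex.add_im]
        ring)
    (fun a => by
      simp only [mul_def, one_def]
      ext <;> simp)
    (fun a => by
      simp only [mul_def, inv_def, one_def]
      ext
      · simp
      · simp [Complex.mul_im, Complex.conj_re, Complex.conj_im]
        ring)

end Heis

/-- The theta function `Θ_{ℓ,c}(φ)` on the Heisenberg group. -/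
noncomputable def theta (ℓ c : ℝ) (φ : ℝ → ℂ) (p : Heis) : ℂ :=
  ∑' k : ℤ,
    Complex.exp (((2 * Real.pi * ℓ * (p.t - p.z.re * (c / ℓ + 2 * (k : ℝ) + p.z.im)) : ℝ) : ℂ) *
        Complex.I) *
      φ (c / (2 * ℓ) + (k : ℝ) + p.z.im)

/-- Terms of the form `exp (2πi·)` agree at real arguments that differ by an integer. -/
theorem cexp_two_pi_mul_eq_of_sub_int {a b : ℝ} (n : ℤ) (h : a = b + n) :
    Complex.exp (((2 * Real.pi * a : ℝ) : ℂ) * Complex.I) =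
      Complex.exp (((2 * Real.pi * b : ℝ) : ℂ) * Complex.I) := by
  rw [Complex.exp_eq_exp_iff_exists_int]
  refine ⟨n, ?_⟩
  subst h
  push_cast
  ring

theorem theta_one_mul {ℓ : ℝ} (hℓ : ℓ ≠ 0) {m : ℤ} (hm : 2 * ℓ = m) (c : ℤ) (φ : ℝ → ℂ)
    (p : Heis) : theta ℓ c φ (⟨1, 0⟩ * p) = theta ℓ c φ p := by
  refine tsum_congr fun k => ?_
  congr 1
  · simp only [mul_assoc (2 * Real.pi)]
    apply cexp_two_pi_mul_eq_of_sub_int (-c - m * k)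
    simp only [Heis.mul_def, map_one, one_mul, Complex.add_re, Complex.add_im, Complex.one_re,
      Complex.one_im]
    push_cast
    rw [← hm]
    field_simp
    ring
  · simp [Heis.mul_def]

theorem theta_I_mul (ℓ c : ℝ) (φ : ℝ → ℂ) (p : Heis) :
    theta ℓ c φ (⟨Complex.I, 0⟩ * p) = theta ℓ c φ p := by
  unfold theta
  conv_rhs => rw [← (Equiv.addRight (1 : ℤ)).tsum_eq]
  refine tsum_congr fun k => ?_
  simp only [Heis.mul_def, Equiv.coe_addRight, Complex.add_re, Complex.add_im, Complex.I_re,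
    Complex.I_im, Complex.mul_im, Complex.conj_I, Complex.neg_re, Complex.neg_im]
  push_cast
  congr 2
  · ring
  · ring

theorem theta_central_mul {ℓ s : ℝ} {m : ℤ} (hm : ℓ * s = m) (c : ℝ) (φ : ℝ → ℂ) (p : Heis) :
    theta ℓ c φ (⟨0, s⟩ * p) = theta ℓ c φ p := by
  refine tsum_congr fun k => ?_
  congr 1
  · simp only [mul_assoc (2 * Real.pi)]
    apply cexp_two_pi_mul_eq_of_sub_int m
    simp only [Heis.mul_def, map_zero, zero_mul, zero_add, Complex.zero_im]
    rw [← hm]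
    ring
  · simp [Heis.mul_def]

/-- A function invariant under left translation by a set is invariant under left translation by
the subgroup generated by that set. -/
theorem apply_mul_eq_of_mem_closure {G α : Type*} [Group G] {S : Set G} {f : G → α}
    (hS : ∀ g ∈ S, ∀ x, f (g * x) = f x) {g : G} (hg : g ∈ Subgroup.closure S) (x : G) :
    f (g * x) = f x := by
  induction hg using Subgroup.closure_induction generalizing x with
  | mem g hg => exact hS g hg x
  | one => rw [one_mul]
  | mul g h _ _ ihg ihh => rw [mul_assoc, ihg, ihh]
  | inv g _ ih => rw [← ih, mul_inv_cancel_left]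

/-- For `σ ∈ ℤ≥1`, `ℓ ∈ (σ/2)ℤ∖{0}` and `c ∈ ℤ`, the theta function `Θ_{ℓ,c}(φ)` is invariant
under left translation by the three generators of the standard lattice `Λ_σ`, hence by every
element of the subgroup they generate. -/
theorem stmt_6 (σ : ℤ) (hσ : 1 ≤ σ) (ℓ : ℝ) (hmem : ∃ k : ℤ, ℓ = (σ : ℝ) / 2 * k)
    (hℓ : ℓ ≠ 0) (c : ℤ) (φ : SchwartzMap ℝ ℂ) :
    (∀ γ ∈ ({⟨1, 0⟩, ⟨Complex.I, 0⟩, ⟨0, 2 / (σ : ℝ)⟩} : Set Heis),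
      ∀ p : Heis, theta ℓ (c : ℝ) (⇑φ) (γ * p) = theta ℓ (c : ℝ) (⇑φ) p) ∧
    (∀ γ ∈ Subgroup.closure ({⟨1, 0⟩, ⟨Complex.I, 0⟩, ⟨0, 2 / (σ : ℝ)⟩} : Set Heis),
      ∀ p : Heis, theta ℓ (c : ℝ) (⇑φ) (γ * p) = theta ℓ (c : ℝ) (⇑φ) p) := by
  have generators : ∀ γ ∈ ({⟨1, 0⟩, ⟨Complex.I, 0⟩, ⟨0, 2 / (σ : ℝ)⟩} : Set Heis),
      ∀ p : Heis, theta ℓ (c : ℝ) (⇑φ) (γ * p) = theta ℓ (c : ℝ) (⇑φ) p := by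
    obtain ⟨k, hk⟩ := hmem
    have hσ0 : (σ : ℝ) ≠ 0 := by
      exact_mod_cast (by lia : σ ≠ 0)
    rintro γ (rfl | rfl | rfl) p
    · refine theta_one_mul hℓ (m := σ * k) ?_ c φ p
      rw [hk]
      push_cast
      ring
    · exact theta_I_mul ℓ c φ p
    · refine theta_central_mul (m := k) ?_ c φ p
      rw [hk]
      field_simp
  exact ⟨generators, fun γ hγ p => apply_mul_eq_of_mem_closure generators hγ p⟩
end

section
/- Let ℓ ∈ ℝ with ℓ ≠ 0, and let f : ℝ² → ℂ be continuous with f(x+1, y) = f(x,y) and f(x, y+1) = exp(4πiℓx) · f(x,y) for all (x,y) ∈ ℝ² (so |f| is doubly periodic, hence bounded). If ∫₀¹ exp(2πicx) · ( ∫_ℝ f(x,y) · conj(φ(y)) dy ) dx = 0 for every c ∈ ℤ and every Schwartz function φ : ℝ → ℂ, then f is identically zero. -/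
open MeasureTheory

/-- A continuous periodic function on the line all of whose Fourier coefficients vanish is zero. -/
theorem Function.Periodic.eq_zero_of_integral_exp_mul_eq_zero {g : ℝ → ℂ} (hg : Continuous g)
    (hper : Function.Periodic g 1)
    (h : ∀ c : ℤ, (∫ x in (0 : ℝ)..1,
      Complex.exp (((2 * Real.pi * (c : ℝ) * x : ℝ) : ℂ) * Complex.I) * g x) = 0)
    (x : ℝ) : g x = 0 := by
  let G : C(AddCircle (1 : ℝ), ℂ) := ⟨hper.lift, continuous_coinduced_dom.mpr hg⟩
  have hG : ∀ t : ℝ, G (t : AddCircle (1 : ℝ)) = g t := fun t => hper.lift_coe t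
  have hcoeff : fourierCoeff G = 0 := by
    funext n
    rw [fourierCoeff_eq_intervalIntegral _ n 0, zero_add, Pi.zero_apply, ← smul_zero (A := ℂ) (1 / (1 : ℝ)),
      ← h (-n)]
    refine congrArg _ (intervalIntegral.integral_congr fun t _ => ?_)
    simp only [hG, fourier_coe_apply, smul_eq_mul]
    congr 2
    push_cast
    ring
  have hsum := has_pointwise_sum_fourier_series_of_summable (f := G)
    (by rw [hcoeff]; exact summable_zero) (x : AddCircle (1 : ℝ))
  rw [hcoeff, hG] at hsum
  simpa using hsum.unique (by simp)

/-- Fubini's theorem on a strip for a continuous integrand cut off by a compactly supported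
continuous function of the second variable. -/
theorem intervalIntegral_integral_swap_mul_of_hasCompactSupport {F : ℝ → ℝ → ℂ} {ψ : ℝ → ℂ}
    (hF : Continuous fun p : ℝ × ℝ => F p.1 p.2) (hψ : Continuous ψ) (hψs : HasCompactSupport ψ)
    (a b : ℝ) :
    (∫ x in a..b, ∫ y : ℝ, F x y * ψ y) = ∫ y : ℝ, (∫ x in a..b, F x y) * ψ y := by
  simp_rw [← intervalIntegral.integral_mul_const]
  refine intervalIntegral_integral_swap ?_
  have hcont : Continuous (Function.uncurry fun x y : ℝ => F x y * ψ y) :=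
    hF.mul (hψ.comp continuous_snd)
  have hK : IntegrableOn (Function.uncurry fun x y : ℝ => F x y * ψ y)
      (Set.uIcc a b ×ˢ tsupport ψ) :=
    hcont.continuousOn.integrableOn_compact (isCompact_uIcc.prod hψs)
  have hS : IntegrableOn (Function.uncurry fun x y : ℝ => F x y * ψ y)
      (Set.uIoc a b ×ˢ Set.univ) := by
    refine (hK.mono_set (Set.prod_mono Set.uIoc_subset_uIcc subset_rfl)).of_forall_sdiff_eq_zero
      (measurableSet_uIoc.prod MeasurableSet.univ) ?_
    rintro ⟨x, y⟩ ⟨⟨hx, -⟩, hxy⟩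
    have hy : y ∉ tsupport ψ := fun hy => hxy ⟨hx, hy⟩
    simp [image_eq_zero_of_notMem_tsupport hy]
  rwa [IntegrableOn, Measure.volume_eq_prod, ← Measure.prod_restrict, Measure.restrict_univ] at hS

/-- Completeness step: a continuous function on `ℝ²` that is `1`-periodic in `x`,
quasi-periodic in `y` with multiplier `e^{4πiℓx}`, and whose twisted integrals against all
Schwartz functions vanish, is identically zero. -/
theorem stmt_9 (ℓ : ℝ) (hℓ : ℓ ≠ 0) (f : ℝ → ℝ → ℂ)
    (hf : Continuous fun p : ℝ × ℝ => f p.1 p.2)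
    (hper : ∀ x y : ℝ, f (x + 1) y = f x y)
    (hqper : ∀ x y : ℝ,
      f x (y + 1) = Complex.exp (((4 * Real.pi * ℓ * x : ℝ) : ℂ) * Complex.I) * f x y)
    (horth : ∀ (c : ℤ) (φ : SchwartzMap ℝ ℂ),
      (∫ x in (0:ℝ)..1, Complex.exp (((2 * Real.pi * (c : ℝ) * x : ℝ) : ℂ) * Complex.I) *
        ∫ y : ℝ, f x y * (starRingEnd ℂ) (φ y)) = 0) :
    ∀ x y : ℝ, f x y = 0 := by
  have hE : ∀ c : ℤ, Continuous fun p : ℝ × ℝ =>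
      Complex.exp (((2 * Real.pi * (c : ℝ) * p.1 : ℝ) : ℂ) * Complex.I) * f p.1 p.2 :=
    fun c => Continuous.mul (by fun_prop) hf
  have hcoeff : ∀ (c : ℤ) (y : ℝ), (∫ x in (0 : ℝ)..1,
      Complex.exp (((2 * Real.pi * (c : ℝ) * x : ℝ) : ℂ) * Complex.I) * f x y) = 0 := by
    intro c
    have hcont : Continuous fun y : ℝ => ∫ x in (0 : ℝ)..1,
        Complex.exp (((2 * Real.pi * (c : ℝ) * x : ℝ) : ℂ) * Complex.I) * f x y :=
      intervalIntegral.continuous_parametric_intervalIntegral_of_continuous'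
        (f := fun y x =>
          Complex.exp (((2 * Real.pi * (c : ℝ) * x : ℝ) : ℂ) * Complex.I) * f x y)
        ((hE c).comp continuous_swap) 0 1
    refine congrFun ((hcont.ae_eq_iff_eq volume continuous_const).mp
      (ae_eq_zero_of_integral_contDiff_smul_eq_zero hcont.locallyIntegrable fun g hg hgs => ?_))
    have hs : HasCompactSupport fun y => (g y : ℂ) := hgs.comp_left Complex.ofReal_zero
    have hsmooth : ContDiff ℝ (⊤ : ℕ∞) fun y => (g y : ℂ) :=
      Complex.ofRealCLM.contDiff.comp hg
    have key := horth c (hs.toSchwartzMap hsmooth)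
    have hφ : ∀ y, hs.toSchwartzMap hsmooth y = (g y : ℂ) := fun _ => rfl
    simp only [hφ, Complex.conj_ofReal, ← integral_const_mul, ← mul_assoc] at key
    rw [intervalIntegral_integral_swap_mul_of_hasCompactSupport (hE c) hsmooth.continuous hs]
      at key
    simpa only [Complex.real_smul, mul_comm] using key
  intro x y
  exact Function.Periodic.eq_zero_of_integral_exp_mul_eq_zero (g := fun x => f x y)
    (hf.comp (by fun_prop : Continuous fun x : ℝ => (x, y))) (fun x => hper x y)
    (fun c => hcoeff c y) x
end

section
/- Define λ₂(j,ν) = ν² − 4 + j²/3 and λ₃(j,ν) = (j+3)·(ν² − (j−6)²/9) for (j,ν) ∈ ℂ². Then λ₂ ∘ S₁ = λ₂, λ₂ ∘ S₂ = λ₂, λ₃ ∘ S₁ = λ₃ and λ₃ ∘ S₂ = λ₃. Moreover, for all (j,ν), (j₁,ν₁) ∈ ℂ², the two equalities λ₂(j₁,ν₁) = λ₂(j,ν) and λ₃(j₁,ν₁) = λ₃(j,ν) hold simultaneously if and only if (j₁,ν₁) belongs to the set {(j,ν), (j,−ν), ((3ν−j)/2, (j+ν)/2), ((3ν−j)/2,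 −(j+ν)/2), ((−3ν−j)/2, (ν−j)/2), ((−3ν−j)/2, −(ν−j)/2)}, i.e. to the orbit of (j,ν) under the Weyl group generated by S₁ and S₂. -/
/-- The Weyl group generator `S₁(j,ν) = ((3ν−j)/2, (j+ν)/2)`. -/
noncomputable def S1 (p : ℂ × ℂ) : ℂ × ℂ := ((3 * p.2 - p.1) / 2, (p.1 + p.2) / 2)

/-- The Weyl group generator `S₂(j,ν) = ((−3ν−j)/2, (ν−j)/2)`. -/
noncomputable def S2 (p : ℂ × ℂ) : ℂ × ℂ := ((-(3 * p.2) - p.1) / 2, (p.2 - p.1) / 2)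

/-- `λ₂(j,ν) = ν² − 4 + j²/3`, the eigenvalue of the Casimir element. -/
noncomputable def lam2 (p : ℂ × ℂ) : ℂ := p.2 ^ 2 - 4 + p.1 ^ 2 / 3

/-- `λ₃(j,ν) = (j+3)(ν² − (j−6)²/9)`, the eigenvalue of the cubic generator `Δ₃`. -/
noncomputable def lam3 (p : ℂ × ℂ) : ℂ := (p.1 + 3) * (p.2 ^ 2 - (p.1 - 6) ^ 2 / 9)

/-- `λ₂` and `λ₃` are invariant under `S₁` and `S₂`, and two points of `ℂ²` give the same
values of `(λ₂, λ₃)` exactly when they lie in the same orbit of the Weyl group generated by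
`S₁` and `S₂`. -/
theorem stmt_14 :
    (∀ p : ℂ × ℂ, lam2 (S1 p) = lam2 p) ∧ (∀ p : ℂ × ℂ, lam2 (S2 p) = lam2 p) ∧
    (∀ p : ℂ × ℂ, lam3 (S1 p) = lam3 p) ∧ (∀ p : ℂ × ℂ, lam3 (S2 p) = lam3 p) ∧
    (∀ j ν j₁ ν₁ : ℂ,
      (lam2 (j₁, ν₁) = lam2 (j, ν) ∧ lam3 (j₁, ν₁) = lam3 (j, ν)) ↔
      (j₁, ν₁) ∈ ({(j, ν), (j, -ν),
        ((3 * ν - j) / 2, (j + ν) / 2), ((3 * ν - j) / 2, -((j + ν) / 2)),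
        ((-(3 * ν) - j) / 2, (ν - j) / 2), ((-(3 * ν) - j) / 2, -((ν - j) / 2))} :
          Set (ℂ × ℂ))) := by
  refine ⟨fun p => ?_, fun p => ?_, fun p => ?_, fun p => ?_, fun j ν j₁ ν₁ => ?_⟩
  · simp only [lam2, S1]; ring
  · simp only [lam2, S2]; ring
  · simp only [lam3, S1]; ring
  · simp only [lam3, S2]; ring
  simp only [lam2, lam3, Set.mem_insert_iff, Set.mem_singleton_iff, Prod.mk.injEq]
  constructor
  · rintro ⟨h2, h3⟩
    have hcubic : (j₁ - j) * ((j₁ - (3 * ν - j) / 2) * (j₁ - (-(3 * ν) - j) / 2)) = 0 := by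
      linear_combination (9 / 4 * (j₁ + 3)) * h2 - 9 / 4 * h3
    rcases mul_eq_zero.mp hcubic with h | h
    · obtain rfl : j₁ = j := sub_eq_zero.mp h
      rcases sq_eq_sq_iff_eq_or_eq_neg.mp (show ν₁ ^ 2 = ν ^ 2 by linear_combination h2)
        with h | h <;> simp [h]
    rcases mul_eq_zero.mp h with h | h
    · obtain rfl : j₁ = _ := sub_eq_zero.mp h
      rcases sq_eq_sq_iff_eq_or_eq_neg.mp
        (show ν₁ ^ 2 = ((j + ν) / 2) ^ 2 by linear_combination h2) with h | h <;> simp [h]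
    · obtain rfl : j₁ = _ := sub_eq_zero.mp h
      rcases sq_eq_sq_iff_eq_or_eq_neg.mp
        (show ν₁ ^ 2 = ((ν - j) / 2) ^ 2 by linear_combination h2) with h | h <;> simp [h]
  · rintro (⟨rfl, rfl⟩ | ⟨rfl, rfl⟩ | ⟨rfl, rfl⟩ | ⟨rfl, rfl⟩ | ⟨rfl, rfl⟩ | ⟨rfl, rfl⟩) <;>
      constructor <;> ring
end

section
/- Let x ∈ ℝ and let A, B ∈ ℝ satisfy 2A ∈ ℤ, 2B ∈ ℤ and A − B ∈ ℤ (so A and B are either both integers or both half-integers). Then Γ(A+a−x)·Γ(B+b−x) / (Γ(A+a+x)·Γ(B+b+x)) > 0 for all a, b ∈ ℤ≥0 if and only if either (A and B are integers with A ≥ 1 and B ≥ 1 and |x| < min(A,B)) or (A and B are half-integers, i.e. A − 1/2 ∈ ℤ, and |x| < max(1/2, min(A,B))). Here Γ denotes the real Gamma function, extended (as in Mathlib) by the value 0 at nonpositive integers, and division by zero equals zero; at parameter values where a Gamma factor is at a pole, the quotient is then 0 and hence not positive. -/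
/-- Positivity at two consecutive arguments forces the shift factor `(u - x) / (u + x)` to be
positive. -/
lemma abs_lt_abs_of_Gamma_quotient_pos {u x g h : ℝ}
    (h0 : 0 < Real.Gamma (u - x) * g / (Real.Gamma (u + x) * h))
    (h1 : 0 < Real.Gamma (u + 1 - x) * g / (Real.Gamma (u + 1 + x) * h)) : |x| < |u| := by
  have hs : u - x ≠ 0 := by
    intro hs
    simp [hs] at h0
  have ht : u + x ≠ 0 := by
    intro ht
    simp [ht] at h0
  rw [show u + 1 - x = (u - x) + 1 by ring, show u + 1 + x = (u + x) + 1 by ring,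
    Real.Gamma_add_one hs, Real.Gamma_add_one ht, mul_assoc, mul_assoc, mul_div_mul_comm] at h1
  have hst : 0 < (u - x) / (u + x) := pos_of_mul_pos_left h1 h0.le
  have hmul : 0 < (u - x) * (u + x) := by
    rcases div_pos_iff.mp hst with ⟨h, h'⟩ | ⟨h, h'⟩
    · exact mul_pos h h'
    · exact mul_pos_of_neg_of_neg h h'
  exact sq_lt_sq.mp (by nlinarith)

/-- At a half-integer `c ≤ 1/2`, the values `Γ(c - x)` and `Γ(c + x)` have the same sign when
`|x| < 1/2`. -/
lemma Gamma_mul_Gamma_half_sub_nat_pos {x : ℝ} (hx : |x| < 1 / 2) (n : ℕ) :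
    0 < Real.Gamma (1 / 2 - n - x) * Real.Gamma (1 / 2 - n + x) := by
  obtain ⟨hx1, hx2⟩ := abs_lt.mp hx
  induction n with
  | zero =>
    exact mul_pos (Real.Gamma_pos_of_pos (by push_cast; linarith))
      (Real.Gamma_pos_of_pos (by push_cast; linarith))
  | succ n ih =>
    have hn : (0 : ℝ) ≤ n := n.cast_nonneg
    have hs : 1 / 2 - ((n + 1 : ℕ) : ℝ) - x < 0 := by push_cast; linarith
    have ht : 1 / 2 - ((n + 1 : ℕ) : ℝ) + x < 0 := by push_cast; linarith
    rw [show (1 / 2 - (n : ℝ) - x) = (1 / 2 - ((n + 1 : ℕ) : ℝ) - x) + 1 by push_cast; ring,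
      show (1 / 2 - (n : ℝ) + x) = (1 / 2 - ((n + 1 : ℕ) : ℝ) + x) + 1 by push_cast; ring,
      Real.Gamma_add_one hs.ne, Real.Gamma_add_one ht.ne, mul_mul_mul_comm] at ih
    exact pos_of_mul_pos_right ih (mul_pos_of_neg_of_neg hs ht).le

lemma Gamma_div_Gamma_pos_of_abs_lt {u x : ℝ} (hx : |x| < u) :
    0 < Real.Gamma (u - x) / Real.Gamma (u + x) := by
  obtain ⟨hx1, hx2⟩ := abs_lt.mp hx
  exact div_pos (Real.Gamma_pos_of_pos (by linarith)) (Real.Gamma_pos_of_pos (by linarith))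

lemma Gamma_div_Gamma_pos_of_half_int {u x : ℝ} (hu : ∃ m : ℤ, u - 1 / 2 = m)
    (hx : |x| < 1 / 2) : 0 < Real.Gamma (u - x) / Real.Gamma (u + x) := by
  obtain ⟨m, hm⟩ := hu
  rcases le_total 0 m with h | h
  · have : (0 : ℝ) ≤ m := by exact_mod_cast h
    exact Gamma_div_Gamma_pos_of_abs_lt (by linarith)
  · obtain ⟨n, hn⟩ := Int.exists_eq_neg_ofNat h
    have hu : u = 1 / 2 - n := by
      rw [hn] at hm
      push_cast at hm
      linarith
    rw [hu]
    exact div_pos_iff.mpr (mul_pos_iff.mp (Gamma_mul_Gamma_half_sub_nat_pos hx n))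

lemma one_le_and_abs_lt_of_int {u x : ℝ} (hu : ∃ m : ℤ, u = m)
    (h : ∀ a : ℕ, |x| < |u + a|) : 1 ≤ u ∧ |x| < u := by
  obtain ⟨m, rfl⟩ := hu
  rcases le_or_gt m 0 with hm | hm
  · obtain ⟨n, rfl⟩ := Int.exists_eq_neg_ofNat hm
    have := h n
    simp only [Int.cast_neg, Int.cast_natCast, neg_add_cancel, abs_zero] at this
    exact absurd this (abs_nonneg x).not_gt
  · have h1 : (1 : ℝ) ≤ m := by exact_mod_cast hm
    have := h 0
    rw [Nat.cast_zero, add_zero, abs_of_pos (by linarith : (0 : ℝ) < m)] at this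
    exact ⟨h1, this⟩

lemma abs_lt_max_half_of_half_int {u x : ℝ} (hu : ∃ m : ℤ, u - 1 / 2 = m)
    (h : ∀ a : ℕ, |x| < |u + a|) : |x| < max (1 / 2) u := by
  obtain ⟨m, hm⟩ := hu
  rcases le_total 0 m with hm0 | hm0
  · have h1 : (0 : ℝ) ≤ m := by exact_mod_cast hm0
    have := h 0
    rw [Nat.cast_zero, add_zero, abs_of_pos (by linarith : 0 < u)] at this
    exact lt_max_of_lt_right this
  · obtain ⟨n, rfl⟩ := Int.exists_eq_neg_ofNat hm0
    have := h n
    push_cast at hm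
    rw [show u + n = 1 / 2 by linarith, abs_of_pos (by norm_num : (0 : ℝ) < 1 / 2)] at this
    exact lt_max_of_lt_left this


/-- Positivity of the Gamma-factor quotient `Γ(A+a−x)Γ(B+b−x)/(Γ(A+a+x)Γ(B+b+x))` for all
`a,b ∈ ℤ≥0`, for `A ≡ B mod ℤ` both in `(1/2)ℤ`: it holds iff either `A,B` are integers
`≥ 1` with `|x| < min(A,B)`, or `A,B` are half-integers with `|x| < max(1/2, min(A,B))`. -/
theorem stmt_18 (x A B : ℝ)
    (h2A : ∃ m : ℤ, 2 * A = (m : ℝ)) (h2B : ∃ m : ℤ, 2 * B = (m : ℝ))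
    (hAB : ∃ m : ℤ, A - B = (m : ℝ)) :
    (∀ a b : ℕ,
        0 < Real.Gamma (A + (a : ℝ) - x) * Real.Gamma (B + (b : ℝ) - x) /
              (Real.Gamma (A + (a : ℝ) + x) * Real.Gamma (B + (b : ℝ) + x))) ↔
      (((∃ m : ℤ, A = (m : ℝ)) ∧ (∃ m : ℤ, B = (m : ℝ)) ∧ 1 ≤ A ∧ 1 ≤ B ∧ |x| < min A B) ∨
       ((∃ m : ℤ, A - 1 / 2 = (m : ℝ)) ∧ |x| < max (1 / 2) (min A B))) := by
  have hAB' : (∃ m : ℤ, A = m) → ∃ m : ℤ, B = m := by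
    rintro ⟨m, hm⟩
    obtain ⟨k, hk⟩ := hAB
    exact ⟨m - k, by push_cast; linarith⟩
  have hAB_half : (∃ m : ℤ, A - 1 / 2 = m) → ∃ m : ℤ, B - 1 / 2 = m := by
    rintro ⟨m, hm⟩
    obtain ⟨k, hk⟩ := hAB
    exact ⟨m - k, by push_cast; linarith⟩
  constructor
  · intro h
    have hA : ∀ a : ℕ, |x| < |A + a| := fun a => by
      have h1 := h (a + 1) 0
      rw [Nat.cast_succ, ← add_assoc] at h1
      exact abs_lt_abs_of_Gamma_quotient_pos (h a 0) h1
    have hB : ∀ b : ℕ, |x| < |B + b| := fun b => by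
      have h0 := h 0 b
      have h1 := h 0 (b + 1)
      rw [Nat.cast_succ, ← add_assoc] at h1
      rw [mul_comm, mul_comm (Real.Gamma (_ + x))] at h0 h1
      exact abs_lt_abs_of_Gamma_quotient_pos h0 h1
    obtain ⟨m, hm⟩ := h2A
    rcases Int.even_or_odd' m with ⟨k, rfl | rfl⟩
    · have hAint : ∃ m : ℤ, A = m := ⟨k, by push_cast at hm; linarith⟩
      obtain ⟨hA1, hAx⟩ := one_le_and_abs_lt_of_int hAint hA
      obtain ⟨hB1, hBx⟩ := one_le_and_abs_lt_of_int (hAB' hAint) hB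
      exact Or.inl ⟨hAint, hAB' hAint, hA1, hB1, lt_min hAx hBx⟩
    · have hA_half : ∃ m : ℤ, A - 1 / 2 = m := ⟨k, by push_cast at hm; linarith⟩
      refine Or.inr ⟨hA_half, ?_⟩
      rw [max_min_distrib_left]
      exact lt_min (abs_lt_max_half_of_half_int hA_half hA)
        (abs_lt_max_half_of_half_int (hAB_half hA_half) hB)
  · intro h a b
    rw [mul_div_mul_comm]
    have ha : (0 : ℝ) ≤ a := a.cast_nonneg
    have hb : (0 : ℝ) ≤ b := b.cast_nonneg
    have of_lt_min (hx : |x| < min A B) :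
        0 < Real.Gamma (A + a - x) / Real.Gamma (A + a + x) *
          (Real.Gamma (B + b - x) / Real.Gamma (B + b + x)) := by
      obtain ⟨hxA, hxB⟩ := lt_min_iff.mp hx
      exact mul_pos (Gamma_div_Gamma_pos_of_abs_lt (by linarith))
        (Gamma_div_Gamma_pos_of_abs_lt (by linarith))
    rcases h with ⟨-, -, -, -, hx⟩ | ⟨hA, hx⟩
    · exact of_lt_min hx
    · rcases lt_max_iff.mp hx with hx | hx
      · have half_int_add {u : ℝ} (n : ℕ) (hu : ∃ m : ℤ, u - 1 / 2 = m) :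
            ∃ m : ℤ, u + n - 1 / 2 = m := by
          obtain ⟨m, hm⟩ := hu
          exact ⟨m + n, by push_cast; linarith⟩
        exact mul_pos (Gamma_div_Gamma_pos_of_half_int (half_int_add a hA) hx)
          (Gamma_div_Gamma_pos_of_half_int (half_int_add b (hAB_half hA)) hx)
      · exact of_lt_min hx
end
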